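/- Let P be a finite ranked poset and let S ⊆ P be a chain all of whose elements have ranks of the same parity (rk(p) ≡ rk(q) (mod 2) for all p, q ∈ S). Then the statistic f : J(P) → ℤ defined by f(I) = Σ_{p ∈ S} T_p(I) is 0-mesic with respect to gyration: for every orbit O of gyr on J(P), the sum of f over O is 0. -/

import Mathlib

open scoped Classical

/-- The set of order ideals (lower sets) of a poset `P`. -/
abbrev OrderIdeal (P : Type*) [PartialOrder P] := {I : Set P // IsLowerSet I}

variable {P : Type*} [PartialOrder P]

/-- The toggle `t_p : J(P) → J(P)`: it adds `p` if `p` is a minimal element of the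
complement of `I`, removes `p` if `p` is a maximal element of `I`, and otherwise fixes `I`. -/
noncomputable def toggle (p : P) (I : OrderIdeal P) : OrderIdeal P :=
  if h₁ : p ∉ I.1 ∧ ∀ q, q < p → q ∈ I.1 then
    ⟨I.1 ∪ {p}, by
      intro a b hba ha
      rcases ha with ha | ha
      · exact Or.inl (I.2 hba ha)
      · rw [Set.mem_singleton_iff] at ha
        subst ha
        rcases eq_or_lt_of_le hba with h | h
        · exact Or.inr (by rw [Set.mem_singleton_iff]; exact h)
        · exact Or.inl (h₁.2 b h)⟩
  else if h₂ : p ∈ I.1 ∧ ∀ q, p < q → q ∉ I.1 then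
    ⟨I.1 \ {p}, by
      intro a b hba ha
      refine ⟨I.2 hba ha.1, ?_⟩
      intro hb
      rw [Set.mem_singleton_iff] at hb
      subst hb
      rcases eq_or_lt_of_le hba with h | h
      · exact ha.2 (by rw [Set.mem_singleton_iff]; exact h.symm)
      · exact h₂.2 a h ha.1⟩
  else I

/-- Rowmotion: `I` is sent to the order ideal generated by the minimal elements of `P∖I`. -/
noncomputable def rowmotion (I : OrderIdeal P) : OrderIdeal P :=
  ⟨{x | ∃ m, m ∉ I.1 ∧ (∀ q, q < m → q ∈ I.1) ∧ x ≤ m}, by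
    intro a b hba ha
    obtain ⟨m, h1, h2, h3⟩ := ha
    exact ⟨m, h1, h2, hba.trans h3⟩⟩

/-- The toggleability statistic `T_p`. -/
noncomputable def togStat (p : P) (I : OrderIdeal P) : ℤ :=
  if p ∉ I.1 ∧ ∀ q, q < p → q ∈ I.1 then 1
  else if p ∈ I.1 ∧ ∀ q, p < q → q ∉ I.1 then -1
  else 0


/-- Gyration: first toggle all elements of even rank, then all elements of odd rank.
(Toggles at distinct elements whose ranks have equal parity commute, so this is
independent of the order chosen within each parity class.) -/
noncomputable def gyration [Fintype P] (rk : P → ℕ) : OrderIdeal P → OrderIdeal P :=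
  (((Finset.univ.filter fun p : P => rk p % 2 = 1).toList.map toggle).foldr (· ∘ ·) id) ∘
    (((Finset.univ.filter fun p : P => rk p % 2 = 0).toList.map toggle).foldr (· ∘ ·) id)



/-- Condition: `p` can be toggled into `I`. -/
def CanIn (p : P) (I : OrderIdeal P) : Prop := p ∉ I.1 ∧ ∀ q, q < p → q ∈ I.1

/-- Condition: `p` can be toggled out of `I`. -/
def CanOut (p : P) (I : OrderIdeal P) : Prop := p ∈ I.1 ∧ ∀ q, p < q → q ∉ I.1

theorem mem_toggle (p x : P) (I : OrderIdeal P) :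
    x ∈ (toggle p I).1 ↔ (x ≠ p ∧ x ∈ I.1) ∨ (x = p ∧ (CanIn p I ∨ (p ∈ I.1 ∧ ¬ CanOut p I))) := by
  unfold toggle CanIn CanOut
  split_ifs with h1 h2
  · by_cases hx : x = p <;> simp [hx, h1]
    exact fun q hq => h1.2 q hq
  · by_cases hx : x = p
    · subst hx
      simp only [Set.mem_diff, Set.mem_singleton_iff]
      tauto
    · simp [hx]
  · by_cases hx : x = p
    · subst hx
      simp only [ne_eq]
      tauto
    · simp [hx]

theorem mem_toggle_ne {p x : P} (h : x ≠ p) (I : OrderIdeal P) :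
    x ∈ (toggle p I).1 ↔ x ∈ I.1 := by
  rw [mem_toggle]; tauto

theorem mem_toggle_self (p : P) (I : OrderIdeal P) :
    p ∈ (toggle p I).1 ↔ (CanIn p I ∨ (p ∈ I.1 ∧ ¬ CanOut p I)) := by
  rw [mem_toggle]; tauto

theorem canIn_toggle_self (p : P) (I : OrderIdeal P) : CanIn p (toggle p I) ↔ CanOut p I := by
  have e : (∀ q, q < p → q ∈ (toggle p I).1) ↔ (∀ q, q < p → q ∈ I.1) :=
    forall₂_congr fun q hq => mem_toggle_ne hq.ne I
  have key : CanIn p (toggle p I) ↔ (p ∉ (toggle p I).1 ∧ ∀ q, q < p → q ∈ I.1) := by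
    rw [← e]; rfl
  rw [key, mem_toggle_self]
  have h1 : p ∈ I.1 → ∀ q, q < p → q ∈ I.1 := fun h q hq => I.2 hq.le h
  have h2 : CanIn p I ↔ p ∉ I.1 ∧ ∀ q, q < p → q ∈ I.1 := Iff.rfl
  have h3 : CanOut p I → p ∈ I.1 := fun h => h.1
  tauto

theorem canOut_toggle_self (p : P) (I : OrderIdeal P) : CanOut p (toggle p I) ↔ CanIn p I := by
  have e : (∀ q, p < q → q ∉ (toggle p I).1) ↔ (∀ q, p < q → q ∉ I.1) :=
    forall₂_congr fun q hq => not_congr (mem_toggle_ne hq.ne' I)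
  have key : CanOut p (toggle p I) ↔ (p ∈ (toggle p I).1 ∧ ∀ q, p < q → q ∉ I.1) := by
    rw [← e]; rfl
  rw [key, mem_toggle_self]
  have h1 : p ∉ I.1 → ∀ q, p < q → q ∉ I.1 := fun h q hq hh => h (I.2 hq.le hh)
  have h2 : CanOut p I ↔ p ∈ I.1 ∧ ∀ q, p < q → q ∉ I.1 := Iff.rfl
  have h3 : CanIn p I → p ∉ I.1 := fun h => h.1
  tauto

theorem toggle_toggle (p : P) (I : OrderIdeal P) : toggle p (toggle p I) = I := by
  apply Subtype.ext
  ext x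
  by_cases h : x = p
  · subst h
    rw [mem_toggle_self, canIn_toggle_self, canOut_toggle_self, mem_toggle_self]
    have h2 : CanOut x I → x ∈ I.1 := fun h => h.1
    have h3 : CanIn x I → x ∉ I.1 := fun h => h.1
    tauto
  · rw [mem_toggle_ne h, mem_toggle_ne h]

theorem togStat_eq (p : P) (I : OrderIdeal P) :
    togStat p I = if CanIn p I then 1 else if CanOut p I then -1 else 0 := by
  unfold togStat CanIn CanOut
  split_ifs <;> first | rfl | tauto

/-- Membership indicator. -/
noncomputable def ind (p : P) (I : OrderIdeal P) : ℤ := if p ∈ I.1 then 1 else 0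

theorem ind_toggle_self (p : P) (I : OrderIdeal P) :
    ind p (toggle p I) = ind p I + togStat p I := by
  unfold ind
  rw [togStat_eq]
  simp only [mem_toggle_self]
  have h2 : CanOut p I → p ∈ I.1 := fun h => h.1
  have h3 : CanIn p I → p ∉ I.1 := fun h => h.1
  by_cases a : CanOut p I <;> by_cases b : CanIn p I <;> by_cases c : p ∈ I.1 <;> simp_all

theorem ind_toggle_ne {p q : P} (h : p ≠ q) (I : OrderIdeal P) :
    ind p (toggle q I) = ind p I := by
  unfold ind
  simp only [mem_toggle_ne h]

theorem togStat_toggle_self (p : P) (I : OrderIdeal P) :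
    togStat p (toggle p I) = - togStat p I := by
  rw [togStat_eq, togStat_eq]
  simp only [canIn_toggle_self, canOut_toggle_self]
  have h2 : CanOut p I → p ∈ I.1 := fun h => h.1
  have h3 : CanIn p I → p ∉ I.1 := fun h => h.1
  by_cases a : CanOut p I <;> by_cases b : CanIn p I <;> simp_all

theorem canIn_toggle_aux {p q : P} (h : p ≠ q) (h1 : ¬ q ⋖ p) (I : OrderIdeal P)
    (H : CanIn p I) : CanIn p (toggle q I) := by
  refine ⟨by rw [mem_toggle_ne h]; exact H.1, fun x hx => ?_⟩
  by_cases hxq : x = q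
  · subst hxq
    rw [mem_toggle_self]
    obtain ⟨r, hr, hr'⟩ := exists_lt_lt_of_not_covBy hx h1
    exact Or.inr ⟨H.2 x hx, fun hc => hc.2 r hr (H.2 r hr')⟩
  · rw [mem_toggle_ne hxq]; exact H.2 x hx

theorem canOut_toggle_aux {p q : P} (h : p ≠ q) (h1 : ¬ p ⋖ q) (I : OrderIdeal P)
    (H : CanOut p I) : CanOut p (toggle q I) := by
  refine ⟨by rw [mem_toggle_ne h]; exact H.1, fun x hx => ?_⟩
  by_cases hxq : x = q
  · subst hxq
    rw [mem_toggle_self]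
    obtain ⟨r, hr, hr'⟩ := exists_lt_lt_of_not_covBy hx h1
    rintro (hc | hc)
    · exact H.2 r hr (hc.2 r hr')
    · exact H.2 x hx hc.1
  · rw [mem_toggle_ne hxq]; exact H.2 x hx

theorem togStat_toggle_ne {p q : P} (h : p ≠ q) (h1 : ¬ q ⋖ p) (h2 : ¬ p ⋖ q)
    (I : OrderIdeal P) : togStat p (toggle q I) = togStat p I := by
  have a : CanIn p (toggle q I) ↔ CanIn p I :=
    ⟨fun H => by simpa only [toggle_toggle] using canIn_toggle_aux h h1 _ H,
      canIn_toggle_aux h h1 I⟩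
  have b : CanOut p (toggle q I) ↔ CanOut p I :=
    ⟨fun H => by simpa only [toggle_toggle] using canOut_toggle_aux h h2 _ H,
      canOut_toggle_aux h h2 I⟩
  rw [togStat_eq, togStat_eq]
  simp only [a, b]

/-- Composition of toggles along a list. -/
noncomputable def togs (l : List P) : OrderIdeal P → OrderIdeal P :=
  (l.map toggle).foldr (· ∘ ·) id

theorem togs_cons (a : P) (l : List P) (I : OrderIdeal P) :
    togs (a :: l) I = toggle a (togs l I) := rfl

theorem togs_inj (l : List P) : Function.Injective (togs l) := by
  induction l with
  | nil => exact fun _ _ h => h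
  | cons a l ih =>
    intro x y h
    rw [togs_cons, togs_cons] at h
    apply ih
    rw [← toggle_toggle a (togs l x), h, toggle_toggle]

theorem ind_togs_not_mem (p : P) (l : List P) (h : p ∉ l) (I : OrderIdeal P) :
    ind p (togs l I) = ind p I := by
  induction l with
  | nil => rfl
  | cons a l ih =>
    rw [List.mem_cons, not_or] at h
    rw [togs_cons, ind_toggle_ne h.1, ih h.2]

theorem togStat_togs_not_mem (p : P) (l : List P) (h : p ∉ l)
    (hc : ∀ q ∈ l, ¬ q ⋖ p ∧ ¬ p ⋖ q) (I : OrderIdeal P) :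
    togStat p (togs l I) = togStat p I := by
  induction l with
  | nil => rfl
  | cons a l ih =>
    rw [List.mem_cons, not_or] at h
    have := hc a (by simp)
    rw [togs_cons, togStat_toggle_ne h.1 this.1 this.2,
      ih h.2 fun q hq => hc q (List.mem_cons_of_mem _ hq)]

theorem togs_mem (p : P) (l : List P) (h : p ∈ l) (hn : l.Nodup)
    (hc : ∀ q ∈ l, ¬ q ⋖ p ∧ ¬ p ⋖ q) (I : OrderIdeal P) :
    togStat p (togs l I) = - togStat p I ∧ ind p (togs l I) = ind p I + togStat p I := by
  induction l with
  | nil => simp at h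
  | cons a l ih =>
    have hc' : ∀ q ∈ l, ¬ q ⋖ p ∧ ¬ p ⋖ q := fun q hq => hc q (List.mem_cons_of_mem _ hq)
    rw [List.nodup_cons] at hn
    rw [togs_cons]
    by_cases e : p = a
    · subst e
      rw [togStat_toggle_self, ind_toggle_self, togStat_togs_not_mem p l hn.1 hc',
        ind_togs_not_mem p l hn.1]
      exact ⟨rfl, rfl⟩
    · have := hc a (by simp)
      rw [togStat_toggle_ne e this.1 this.2, ind_toggle_ne e]
      exact ih ((List.mem_cons.1 h).resolve_left e) hn.2 hc'

theorem sum_orbit {X : Type*} [DecidableEq X] (g : X → X) (hg : Function.Injective g)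
    (O : Finset X) (hO : ∀ x ∈ O, g x ∈ O) (f : X → ℤ) :
    ∑ x ∈ O, f (g x) = ∑ x ∈ O, f x := by
  have h : O.image g = O := by
    apply Finset.eq_of_subset_of_card_le
    · intro y hy
      obtain ⟨x, hx, rfl⟩ := Finset.mem_image.1 hy
      exact hO x hx
    · rw [Finset.card_image_of_injective _ hg]
  conv_rhs => rw [← h]
  rw [Finset.sum_image (fun _ _ _ _ e => hg e)]

/-- Let `P` be a finite ranked poset and `S` a chain in `P` all of whose elements have
ranks of the same parity. Then the statistic `f(I) = ∑_{p ∈ S} T_p(I)` is 0-mesic with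
respect to gyration: the sum of `f` over every orbit of `gyr` on `J(P)` is `0`. -/
theorem stmt_12 [Fintype P] (rk : P → ℕ) (hrk : ∀ p q : P, q ⋖ p → rk p = rk q + 1)
    (S : Finset P) (hchain : IsChain (· ≤ ·) (S : Set P))
    (hpar : ∀ p ∈ S, ∀ q ∈ S, rk p % 2 = rk q % 2) (I : OrderIdeal P) :
    ∑ J ∈ Finset.univ.filter (fun J => ∃ k : ℕ, (gyration rk)^[k] I = J),
      (∑ p ∈ S, togStat p J) = 0 := by
  have hcov : ∀ p q : P, rk q % 2 = rk p % 2 → ¬ q ⋖ p ∧ ¬ p ⋖ q := by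
    intro p q h
    constructor
    · intro hh; have := hrk _ _ hh; omega
    · intro hh; have := hrk _ _ hh; omega
  set A := (Finset.univ.filter fun p : P => rk p % 2 = 1).toList with hA
  set B := (Finset.univ.filter fun p : P => rk p % 2 = 0).toList with hB
  have mA : ∀ p, p ∈ A ↔ rk p % 2 = 1 := by intro p; simp [hA]
  have mB : ∀ p, p ∈ B ↔ rk p % 2 = 0 := by intro p; simp [hB]
  have nA : A.Nodup := Finset.nodup_toList _
  have nB : B.Nodup := Finset.nodup_toList _
  have hgyr : ∀ J, gyration rk J = togs A (togs B J) := fun J => rfl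
  have hinj : Function.Injective (gyration rk) := (togs_inj A).comp (togs_inj B)
  rw [Finset.sum_comm]
  apply Finset.sum_eq_zero
  intro p _
  have hO : ∀ J ∈ Finset.univ.filter (fun J => ∃ k : ℕ, (gyration rk)^[k] I = J),
      gyration rk J ∈ Finset.univ.filter (fun J => ∃ k : ℕ, (gyration rk)^[k] I = J) := by
    intro J hJ
    rw [Finset.mem_filter] at hJ ⊢
    obtain ⟨_, k, rfl⟩ := hJ
    exact ⟨Finset.mem_univ _, k + 1, Function.iterate_succ_apply' _ _ _⟩
  have hsum := sum_orbit (gyration rk) hinj _ hO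
  rcases Nat.mod_two_eq_zero_or_one (rk p) with h | h
  · have key : ∀ J, togStat p J = ind p (gyration rk J) - ind p J := by
      intro J
      have := (togs_mem p B ((mB p).2 h) nB
        (fun q hq => hcov p q (by rw [(mB q).1 hq, h])) J).2
      rw [hgyr, ind_togs_not_mem p A (by rw [mA]; omega), this]
      ring
    rw [Finset.sum_congr rfl (fun J _ => key J), Finset.sum_sub_distrib, hsum, sub_self]
  · have key : ∀ J, togStat p (gyration rk J) = ind p J - ind p (gyration rk J) := by
      intro J
      have := togs_mem p A ((mA p).2 h) nA
        (fun q hq => hcov p q (by rw [(mA q).1 hq, h])) (togs B J)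
      rw [hgyr, this.1, this.2, ind_togs_not_mem p B (by rw [mB]; omega)]
      ring
    rw [← hsum, Finset.sum_congr rfl (fun J _ => key J), Finset.sum_sub_distrib, hsum, sub_self]
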